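/- arXiv:2012.01713 — 9 statements merged into one kernel-verified Lean document; each statement's English description precedes it below -/
import Mathlib

section
/- Let δ > 0 and let φ : ℝ → ℝ be an integrable, compactly supported function that is smooth on a neighborhood of [0, δ]. Then there exists a function F, holomorphic on ℂ ∖ {−1, −2, −3, …}, such that F(z) = ∫₀^∞ t^z φ(t) dt for every complex z with Re z > −1, and for every positive integer ℓ, (z + ℓ)·F(z) tends to φ^{(ℓ−1)}(0)/(ℓ−1)! as z tends to −ℓ (z ≠ −ℓ). In other words, the function z ↦ ∫₀^∞ t^z φ(t) dt extends to a meromorphic function on ℂ with at most simple poles, located at negative integers, whose residue at z = −ℓ equals φ^{(ℓ−1)}(0)/(ℓ−1)!. -/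
open MeasureTheory Filter

noncomputable def psiAux (φ : ℝ → ℝ) (c : ℕ → ℝ) : ℕ → ℝ → ℂ
  | 0 => fun t => (φ t : ℂ)
  | N + 1 => fun t => psiAux φ c N t -
      (c N : ℂ) • Set.indicator (Set.Ioc (0:ℝ) 1) (fun t : ℝ => (t : ℂ) ^ ((N : ℂ))) t

noncomputable def FAux (φ : ℝ → ℝ) (c : ℕ → ℝ) (N : ℕ) (z : ℂ) : ℂ :=
  mellin (psiAux φ c N) (z + 1) + ∑ k ∈ Finset.range N, (c k : ℂ) * (1 / (z + 1 + k))

lemma psiAux_Ioc (φ : ℝ → ℝ) (c : ℕ → ℝ) (N : ℕ) (t : ℝ) (ht : t ∈ Set.Ioc (0:ℝ) 1) :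
    psiAux φ c N t = ((φ t - ∑ k ∈ Finset.range N, c k * t ^ k : ℝ) : ℂ) := by
  induction N with
  | zero => simp [psiAux]
  | succ N ih =>
    simp only [psiAux, ih, Set.indicator_of_mem ht, Finset.sum_range_succ, smul_eq_mul,
      Complex.cpow_natCast]
    push_cast
    ring

lemma psiAux_gt (φ : ℝ → ℝ) (c : ℕ → ℝ) (N : ℕ) (t : ℝ) (ht : 1 < t) :
    psiAux φ c N t = (φ t : ℂ) := by
  induction N with
  | zero => simp [psiAux]
  | succ N ih =>
    have : t ∉ Set.Ioc (0:ℝ) 1 := fun h => absurd h.2 (not_le.2 ht)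
    simp only [psiAux, ih, Set.indicator_of_notMem this, smul_zero, sub_zero]

lemma psiAux_int (φ : ℝ → ℝ) (c : ℕ → ℝ) (hint : Integrable φ) (N : ℕ) :
    IntegrableOn (psiAux φ c N) (Set.Ioi 0) := by
  induction N with
  | zero => exact (hint.ofReal (𝕜 := ℂ)).integrableOn
  | succ N ih =>
    have h := (hasMellin_cpow_Ioc (N : ℂ) (s := 1)
      (by simp only [Complex.one_re, Complex.natCast_re]; positivity)).1
    have h2 := h.const_smul (c N : ℂ)
    simp only [MellinConvergent, sub_self, Complex.cpow_zero, one_smul] at h2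
    exact ih.sub h2

lemma psiAux_top (φ : ℝ → ℝ) (c : ℕ → ℝ) (hsupp : HasCompactSupport φ) (N : ℕ) (a : ℝ) :
    (psiAux φ c N) =O[atTop] (fun t : ℝ => t ^ (-a)) := by
  have h0 : ∀ᶠ t in atTop, φ t = 0 := by
    have := hsupp.isCompact.isBounded
    obtain ⟨R, hR⟩ := this.subset_closedBall 0
    filter_upwards [eventually_gt_atTop R, eventually_gt_atTop 0] with t ht ht0
    by_contra h
    have := hR (subset_tsupport φ (Function.mem_support.2 h))
    rw [mem_closedBall_zero_iff, Real.norm_of_nonneg ht0.le] at this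
    linarith
  have : psiAux φ c N =ᶠ[atTop] fun _ => (0:ℂ) := by
    filter_upwards [h0, eventually_gt_atTop 1] with t ht h1
    simp [psiAux_gt φ c N t h1, ht]
  exact this.trans_isBigO (Asymptotics.isBigO_zero _ _)

lemma taylorAux (δ : ℝ) (hδ : 0 < δ) (φ : ℝ → ℝ)
    (hsm : ∃ U : Set ℝ, IsOpen U ∧ Set.Icc 0 δ ⊆ U ∧ ContDiffOn ℝ (⊤ : ℕ∞) φ U) (N : ℕ) :
    (fun t => φ t - ∑ k ∈ Finset.range N, (iteratedDeriv k φ 0 / (Nat.factorial k)) * t ^ k)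
      =O[nhds 0] (fun t : ℝ => t ^ N) := by
  obtain ⟨U, hU, hs, hc⟩ := hsm
  obtain ⟨ε, hε, hb⟩ := Metric.isOpen_iff.1 hU 0 (hs ⟨le_rfl, hδ.le⟩)
  have hm : (0:ℝ) ∈ Metric.ball (0:ℝ) ε := Metric.mem_ball_self hε
  have h1 := taylor_isLittleO (n := N) (convex_ball (0:ℝ) ε) hm
    ((hc.mono hb).of_le (by exact_mod_cast le_top))
  rw [Metric.isOpen_ball.nhdsWithin_eq hm] at h1
  simp only [taylor_within_apply, sub_zero] at h1
  have h2 : (fun t : ℝ => (iteratedDeriv N φ 0 / (Nat.factorial N)) * t ^ N) =O[nhds 0]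
    (fun t : ℝ => t ^ N) := Asymptotics.isBigO_const_mul_self _ _ _
  refine (h1.isBigO.add h2).congr_left fun t => ?_
  rw [Finset.sum_range_succ]
  simp only [iteratedDerivWithin_of_isOpen Metric.isOpen_ball hm, smul_eq_mul]
  have : ∀ k, ((Nat.factorial k : ℝ))⁻¹ * t ^ k * iteratedDeriv k φ 0 =
    iteratedDeriv k φ 0 / (Nat.factorial k) * t ^ k := fun k => by ring
  simp only [this]
  ring

lemma psiAux_bot (φ : ℝ → ℝ) (c : ℕ → ℝ) (N : ℕ)
    (h : (fun t => φ t - ∑ k ∈ Finset.range N, c k * t ^ k) =O[nhds 0] (fun t : ℝ => t ^ N)) :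
    (psiAux φ c N) =O[nhdsWithin 0 (Set.Ioi 0)] (fun t : ℝ => t ^ (-(-(N:ℝ)))) := by
  have h1 := (Complex.isBigO_ofReal_left.2 h).mono (nhdsWithin_le_nhds (s := Set.Ioi 0))
  refine h1.congr' ?_ ?_
  · filter_upwards [Ioc_mem_nhdsGT (zero_lt_one (α := ℝ))] with t ht
    exact (psiAux_Ioc φ c N t ht).symm
  · filter_upwards with t
    simp

lemma FAux_succ (φ : ℝ → ℝ) (c : ℕ → ℝ) (N : ℕ) (z : ℂ) (hz : -1 - (N:ℝ) < z.re)
    (hm : MellinConvergent (psiAux φ c N) (z + 1)) :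
    FAux φ c (N + 1) z = FAux φ c N z := by
  have h := hasMellin_cpow_Ioc (N : ℂ) (s := z + 1)
      (by simp only [Complex.add_re, Complex.one_re, Complex.natCast_re]; linarith)
  have h2 := hasMellin_const_smul h.1 (c N : ℂ)
  have h3 := (hasMellin_sub hm h2.1).2
  have h4 : mellin (psiAux φ c (N + 1)) (z + 1) = _ := h3
  rw [FAux, FAux, h4, h2.2, h.2, Finset.sum_range_succ, smul_eq_mul]
  ring

/-- Meromorphic continuation of `z ↦ ∫₀^∞ t^z φ(t) dt`: it extends to a function `F`
holomorphic away from the negative integers, and at each negative integer `-ℓ` it has at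
most a simple pole with residue `φ^{(ℓ-1)}(0)/(ℓ-1)!`. -/
theorem stmt0 (δ : ℝ) (hδ : 0 < δ) (φ : ℝ → ℝ)
    (hint : Integrable φ) (hsupp : HasCompactSupport φ)
    (hsm : ∃ U : Set ℝ, IsOpen U ∧ Set.Icc 0 δ ⊆ U ∧ ContDiffOn ℝ (⊤ : ℕ∞) φ U) :
    ∃ F : ℂ → ℂ,
      DifferentiableOn ℂ F {z : ℂ | ∀ ℓ : ℕ, 1 ≤ ℓ → z ≠ -(ℓ : ℂ)} ∧
      (∀ z : ℂ, -1 < z.re →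
        F z = ∫ t in Set.Ioi (0:ℝ), (t : ℂ) ^ z * (φ t : ℂ)) ∧
      (∀ ℓ : ℕ, 1 ≤ ℓ →
        Tendsto (fun z : ℂ => (z + (ℓ : ℂ)) * F z)
          (nhdsWithin (-(ℓ : ℂ)) {z : ℂ | z ≠ -(ℓ : ℂ)})
          (nhds ((iteratedDeriv (ℓ - 1) φ 0 / (Nat.factorial (ℓ - 1)) : ℝ) : ℂ))) := by
  set c : ℕ → ℝ := fun k => iteratedDeriv k φ 0 / (Nat.factorial k) with hcdef
  have hbot : ∀ N, (psiAux φ c N) =O[nhdsWithin 0 (Set.Ioi 0)] (fun t : ℝ => t ^ (-(-(N:ℝ)))) :=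
    fun N => psiAux_bot φ c N (taylorAux δ hδ φ hsm N)
  have hre : ∀ (N : ℕ) (z : ℂ), -1 - (N:ℝ) < z.re → -(N:ℝ) < (z + 1).re := by
    intro N z hz
    simp only [Complex.add_re, Complex.one_re]; linarith
  have hconv : ∀ (N : ℕ) (z : ℂ), -1 - (N:ℝ) < z.re →
      MellinConvergent (psiAux φ c N) (z + 1) := fun N z hz =>
    mellinConvergent_of_isBigO_rpow (psiAux_int φ c hint N).locallyIntegrableOn
      (psiAux_top φ c hsupp N ((z + 1).re + 1)) (lt_add_one _) (hbot N) (hre N z hz)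
  have hdiff : ∀ (N : ℕ) (z : ℂ), -1 - (N:ℝ) < z.re →
      DifferentiableAt ℂ (fun z => mellin (psiAux φ c N) (z + 1)) z := by
    intro N z hz
    have h : DifferentiableAt ℂ (mellin (psiAux φ c N)) (z + 1) :=
      mellin_differentiableAt_of_isBigO_rpow (psiAux_int φ c hint N).locallyIntegrableOn
        (psiAux_top φ c hsupp N ((z + 1).re + 1)) (lt_add_one _) (hbot N) (hre N z hz)
    have h2 : DifferentiableAt ℂ (fun z : ℂ => z + 1) z := by fun_prop
    exact DifferentiableAt.comp (g := mellin (psiAux φ c N)) z h h2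
  have hmono : ∀ (N M : ℕ) (z : ℂ), N ≤ M → -1 - (N:ℝ) < z.re → FAux φ c M z = FAux φ c N z := by
    intro N M z hNM hz
    induction M, hNM using Nat.le_induction with
    | base => rfl
    | succ M hM ih =>
      have : (N:ℝ) ≤ M := by exact_mod_cast hM
      rw [FAux_succ φ c M z (by linarith) (hconv M z (by linarith)), ih]
  let F : ℂ → ℂ := fun z => FAux φ c ⌈-z.re⌉₊ z
  have hF : ∀ (N : ℕ) (z : ℂ), -1 - (N:ℝ) < z.re → F z = FAux φ c N z := by
    intro N z hz
    have h1 := Nat.le_ceil (-z.re)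
    rcases le_total N ⌈-z.re⌉₊ with h | h
    · exact hmono _ _ z h hz
    · exact (hmono _ _ z h (by linarith)).symm
  have hnhds : ∀ (N : ℕ) (z : ℂ), -1 - (N:ℝ) < z.re → F =ᶠ[nhds z] FAux φ c N := by
    intro N z hz
    filter_upwards [(isOpen_lt continuous_const Complex.continuous_re).mem_nhds hz] with w hw
    exact hF N w hw
  refine ⟨F, ?_, ?_, ?_⟩
  · intro z hz
    have h1 : -1 - ((⌈-z.re⌉₊ : ℕ) : ℝ) < z.re := by
      have h1 := Nat.le_ceil (-z.re)
      linarith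
    refine DifferentiableAt.differentiableWithinAt ?_
    refine DifferentiableAt.congr_of_eventuallyEq ?_ (hnhds _ z h1)
    unfold FAux
    refine (hdiff _ z h1).add (DifferentiableAt.fun_sum fun k _ => ?_)
    have hne : z + 1 + (k:ℂ) ≠ 0 := by
      intro h0
      apply hz (k + 1) (by omega)
      push_cast
      linear_combination h0
    fun_prop (disch := exact hne)
  · intro z hz
    rw [hF 0 z (by simpa using hz)]
    simp [FAux, mellin, psiAux]
  · intro ℓ hℓ
    obtain ⟨m, rfl⟩ : ∃ m, ℓ = m + 1 := ⟨ℓ - 1, by omega⟩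
    have hz : -1 - ((m + 1 : ℕ) : ℝ) < (-((m + 1 : ℕ) : ℂ)).re := by
      simp only [Complex.neg_re, Complex.natCast_re]; linarith
    set z₀ : ℂ := -((m + 1 : ℕ) : ℂ) with hz₀
    have hG : ContinuousAt (fun z : ℂ => (z + ((m + 1 : ℕ) : ℂ)) *
        (mellin (psiAux φ c (m + 1)) (z + 1) +
          ∑ k ∈ Finset.range m, (c k : ℂ) * (1 / (z + 1 + k))) + (c m : ℂ)) z₀ := by
      refine DifferentiableAt.continuousAt (𝕜 := ℂ) ?_
      refine (DifferentiableAt.mul (by fun_prop) ((hdiff _ z₀ hz).add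
        (DifferentiableAt.fun_sum fun k hk => ?_))).add_const _
      have hne : z₀ + 1 + (k:ℂ) ≠ 0 := by
        intro h0
        have hk' := Finset.mem_range.1 hk
        have : (k : ℂ) = m := by
          rw [hz₀] at h0
          push_cast at h0
          linear_combination h0
        have : k = m := by exact_mod_cast this
        omega
      fun_prop (disch := exact hne)
    have hT := hG.tendsto
    have hval : z₀ + ((m + 1 : ℕ) : ℂ) = 0 := by rw [hz₀]; ring
    simp only [hval, zero_mul, zero_add] at hT
    refine (hT.mono_left nhdsWithin_le_nhds).congr' ?_
    filter_upwards [self_mem_nhdsWithin, mem_nhdsWithin_of_mem_nhds (hnhds _ z₀ hz)] with z hzne hzF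
    have hzF' : F z = FAux φ c (m + 1) z := hzF
    have hne : z + 1 + (m:ℂ) ≠ 0 := by
      intro h0
      apply hzne
      rw [hz₀]
      push_cast
      linear_combination h0
    rw [hzF', FAux, Finset.sum_range_succ]
    have : z + ((m + 1 : ℕ) : ℂ) = z + 1 + m := by push_cast; ring
    rw [this]
    field_simp
    ring
end

section
/- Let m ≥ 1 and let f : ℝ^m → ℝ be C⁴ in a neighborhood of 0 with f(0) = 0, ∇f(0) = 0, and ∂_i∂_j f(0) = 0 for all i ≠ j; write κ_i = ∂_i² f(0). Define, for u near 0, g(u) = 1 + ‖∇f(u)‖² and H(u) = Σ_{i,j=1}^m ( δ_{ij} − ∂_i f(u) ∂_j f(u)/g(u) ) ∂_i∂_j f(u) / √(g(u)). Then Σ_{α=1}^m ∂_α² H(0) = Σ_{i,α=1}^m ∂_α² ∂_i² f(0) − ( Σ_{i=1}^m κ_i )·( Σ_{α=1}^m κ_α² ) − 2 Σ_{i=1}^m κ_i³. -/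
/-- The partial derivative `∂_i g(u)` of a function `g : ℝ^m → ℝ`. -/
noncomputable def pd {m : ℕ} (i : Fin m) (g : (Fin m → ℝ) → ℝ) (u : Fin m → ℝ) : ℝ :=
  fderiv ℝ g u (Pi.single i 1)

theorem pd_contDiffAt {m : ℕ} (i : Fin m) {P : (Fin m → ℝ) → ℝ} {u : Fin m → ℝ} {n k : ℕ}
    (hP : ContDiffAt ℝ n P u) (hk : k + 1 ≤ n) : ContDiffAt ℝ k (fun v => pd i P v) u := by
  unfold pd
  have h : ContDiffAt ℝ k (fderiv ℝ P) u := hP.fderiv_right (by exact_mod_cast hk)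
  exact h.clm_apply contDiffAt_const

theorem pd_mul {m : ℕ} (i : Fin m) {P Q : (Fin m → ℝ) → ℝ} {u : Fin m → ℝ}
    (hP : DifferentiableAt ℝ P u) (hQ : DifferentiableAt ℝ Q u) :
    pd i (fun v => P v * Q v) u = P u * pd i Q u + Q u * pd i P u := by
  unfold pd
  rw [fderiv_fun_mul hP hQ]
  simp

theorem pd_add {m : ℕ} (i : Fin m) {P Q : (Fin m → ℝ) → ℝ} {u : Fin m → ℝ}
    (hP : DifferentiableAt ℝ P u) (hQ : DifferentiableAt ℝ Q u) :
    pd i (fun v => P v + Q v) u = pd i P u + pd i Q u := by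
  unfold pd
  rw [fderiv_fun_add hP hQ]
  simp

theorem pd_sum {m : ℕ} (i : Fin m) {ι : Type} (s : Finset ι) {P : ι → (Fin m → ℝ) → ℝ}
    {u : Fin m → ℝ} (hP : ∀ j ∈ s, DifferentiableAt ℝ (P j) u) :
    pd i (fun v => ∑ j ∈ s, P j v) u = ∑ j ∈ s, pd i (P j) u := by
  unfold pd
  rw [fderiv_fun_sum hP]
  simp

theorem pd_const {m : ℕ} (i : Fin m) (c : ℝ) (u : Fin m → ℝ) :
    pd i (fun _ => c) u = 0 := by
  unfold pd
  simp

theorem pd_congr {m : ℕ} (i : Fin m) {P Q : (Fin m → ℝ) → ℝ} {u : Fin m → ℝ}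
    (h : P =ᶠ[nhds u] Q) : pd i P u = pd i Q u := by
  unfold pd
  rw [h.fderiv_eq]

theorem ev_diff {m : ℕ} {P : (Fin m → ℝ) → ℝ} {u : Fin m → ℝ} (hP : ContDiffAt ℝ 2 P u) :
    ∀ᶠ v in nhds u, DifferentiableAt ℝ P v := by
  filter_upwards [hP.eventually (by simp)] with v hv
  exact hv.differentiableAt (by simp)

theorem pd_diff {m : ℕ} (i : Fin m) {P : (Fin m → ℝ) → ℝ} {u : Fin m → ℝ}
    (hP : ContDiffAt ℝ 2 P u) : DifferentiableAt ℝ (fun v => pd i P v) u :=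
  (pd_contDiffAt (n := 2) (k := 1) i hP (by norm_num)).differentiableAt (by simp)

theorem pd2_mul {m : ℕ} (i : Fin m) {P Q : (Fin m → ℝ) → ℝ} {u : Fin m → ℝ}
    (hP : ContDiffAt ℝ 2 P u) (hQ : ContDiffAt ℝ 2 Q u) :
    pd i (fun v => pd i (fun w => P w * Q w) v) u
      = P u * pd i (fun v => pd i Q v) u + 2 * (pd i P u * pd i Q u)
        + Q u * pd i (fun v => pd i P v) u := by
  have hPd := hP.differentiableAt (by simp)
  have hQd := hQ.differentiableAt (by simp)
  have h : (fun v => pd i (fun w => P w * Q w) v) =ᶠ[nhds u]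
      fun v => P v * pd i Q v + Q v * pd i P v := by
    filter_upwards [ev_diff hP, ev_diff hQ] with v h1 h2
    exact pd_mul i h1 h2
  rw [pd_congr i h, pd_add i (hPd.fun_mul (pd_diff i hQ)) (hQd.fun_mul (pd_diff i hP)),
    pd_mul i hPd (pd_diff i hQ), pd_mul i hQd (pd_diff i hP)]
  ring

theorem pd2_add {m : ℕ} (i : Fin m) {P Q : (Fin m → ℝ) → ℝ} {u : Fin m → ℝ}
    (hP : ContDiffAt ℝ 2 P u) (hQ : ContDiffAt ℝ 2 Q u) :
    pd i (fun v => pd i (fun w => P w + Q w) v) u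
      = pd i (fun v => pd i P v) u + pd i (fun v => pd i Q v) u := by
  have h : (fun v => pd i (fun w => P w + Q w) v) =ᶠ[nhds u]
      fun v => pd i P v + pd i Q v := by
    filter_upwards [ev_diff hP, ev_diff hQ] with v h1 h2
    exact pd_add i h1 h2
  rw [pd_congr i h, pd_add i (pd_diff i hP) (pd_diff i hQ)]

theorem pd2_const {m : ℕ} (i : Fin m) (c : ℝ) (u : Fin m → ℝ) :
    pd i (fun v => pd i (fun _ => c) v) u = 0 := by
  simp only [pd_const]

theorem pd2_sum {m : ℕ} (i : Fin m) {ι : Type} (s : Finset ι) {P : ι → (Fin m → ℝ) → ℝ}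
    {u : Fin m → ℝ} (hP : ∀ j ∈ s, ContDiffAt ℝ 2 (P j) u) :
    pd i (fun v => pd i (fun w => ∑ j ∈ s, P j w) v) u
      = ∑ j ∈ s, pd i (fun v => pd i (P j) v) u := by
  have h : (fun v => pd i (fun w => ∑ j ∈ s, P j w) v) =ᶠ[nhds u]
      fun v => ∑ j ∈ s, pd i (P j) v := by
    have : ∀ᶠ v in nhds u, ∀ j ∈ s, DifferentiableAt ℝ (P j) v :=
      (Filter.eventually_all_finset s).2 fun j hj => ev_diff (hP j hj)
    filter_upwards [this] with v h1
    exact pd_sum i s h1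
  rw [pd_congr i h, pd_sum i s fun j hj => pd_diff i (hP j hj)]

/-- For a hypersurface written as the graph of `f : ℝ^m → ℝ`, tangent to `ℝ^m × {0}` at the
origin with principal directions along the coordinate axes (`∂_i∂_j f(0) = 0` for `i ≠ j`,
`κ_i = ∂_i² f(0)`), the Laplacian of `H = (δ_{ij} - ∂_i f ∂_j f / g) ∂_i∂_j f / √g` at the
origin is `Σ_α ∂_α² H(0) = Σ_{i,α} ∂_α²∂_i² f(0) − (Σ_i κ_i)(Σ_α κ_α²) − 2 Σ_i κ_i³`. -/
theorem stmt5 (m : ℕ) (hm : 1 ≤ m) (f : (Fin m → ℝ) → ℝ)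
    (hf : ∃ U : Set (Fin m → ℝ), IsOpen U ∧ (0 : Fin m → ℝ) ∈ U ∧ ContDiffOn ℝ 4 f U)
    (hf0 : f 0 = 0) (hdf0 : ∀ i, pd i f 0 = 0)
    (hmixed : ∀ i j, i ≠ j → pd i (fun v => pd j f v) 0 = 0)
    (κ : Fin m → ℝ) (hκ : ∀ i, κ i = pd i (fun v => pd i f v) 0)
    (g H : (Fin m → ℝ) → ℝ)
    (hg : ∀ u, g u = 1 + ∑ i, (pd i f u) ^ 2)
    (hH : ∀ u, H u = ∑ i, ∑ j,
      ((if i = j then (1:ℝ) else 0) - pd i f u * pd j f u / g u) *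
        pd i (fun v => pd j f v) u / Real.sqrt (g u)) :
    ∑ α, pd α (fun v => pd α H v) 0
      = (∑ i, ∑ α, pd α (fun v => pd α (fun w => pd i (fun w' => pd i f w') w) v) 0)
        - (∑ i, κ i) * (∑ α, (κ α) ^ 2) - 2 * ∑ i, (κ i) ^ 3 := by
  obtain ⟨U, hU, h0U, hfU⟩ := hf
  have hf4 : ContDiffAt ℝ (4 : ℕ) f 0 := hfU.contDiffAt (hU.mem_nhds h0U)
  have hf1 : ∀ i, ContDiffAt ℝ (3 : ℕ) (fun v => pd i f v) 0 := fun i =>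
    pd_contDiffAt i hf4 (by norm_num)
  have hF1 : ∀ i, ContDiffAt ℝ 2 (fun v => pd i f v) 0 := fun i =>
    (hf1 i).of_le (by norm_num)
  have hF2 : ∀ i j, ContDiffAt ℝ 2 (fun w => pd i (fun v => pd j f v) w) 0 := fun i j =>
    pd_contDiffAt (k := 2) i (hf1 j) (by norm_num)
  have hK : ∀ i j, pd i (fun v => pd j f v) 0 = if i = j then κ i else 0 := by
    intro i j
    split_ifs with h
    · subst h; exact (hκ i).symm
    · exact hmixed i j h
  have hg' : g = fun u => 1 + ∑ i, pd i f u * pd i f u := by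
    funext u; rw [hg u]; simp [sq]
  have hgc : ContDiffAt ℝ 2 g 0 := by
    rw [hg']
    exact contDiffAt_const.add (ContDiffAt.sum fun i _ => (hF1 i).mul (hF1 i))
  have hg0 : g 0 = 1 := by simp [hg', hdf0]
  have hgpos : ∀ u, 0 < g u := fun u => by rw [hg u]; positivity
  have hgd : ∀ α, pd α g 0 = 0 := by
    intro α
    have hd := fun i => (hF1 i).differentiableAt (by simp)
    rw [hg', pd_add α (differentiableAt_const _)
      (DifferentiableAt.fun_sum fun i _ => (hd i).fun_mul (hd i)), pd_const,
      pd_sum α _ fun i _ => (hd i).fun_mul (hd i)]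
    simp only [pd_mul α (hd _) (hd _), hdf0]
    simp
  have hgdd : ∀ α, pd α (fun v => pd α g v) 0 = 2 * κ α ^ 2 := by
    intro α
    rw [hg', pd2_add α contDiffAt_const
      (ContDiffAt.sum fun i _ => (hF1 i).mul (hF1 i)), pd2_const,
      pd2_sum α _ fun i _ => (hF1 i).mul (hF1 i)]
    simp only [pd2_mul α (hF1 _) (hF1 _), hdf0, hK]
    simp [sq]
  obtain ⟨r, hr⟩ : ∃ r : (Fin m → ℝ) → ℝ, r = fun u => (Real.sqrt (g u))⁻¹ := ⟨_, rfl⟩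
  have hrc : ContDiffAt ℝ 2 r 0 := by
    rw [hr]
    exact (hgc.sqrt (hgpos 0).ne').inv (Real.sqrt_pos.2 (hgpos 0)).ne'
  have hr0 : r 0 = 1 := by simp [hr, hg0]
  have hrr : (fun u => (r u * r u) * g u) = fun _ => (1 : ℝ) := by
    funext u
    have h1 := Real.mul_self_sqrt (hgpos u).le
    have h2 := (Real.sqrt_pos.2 (hgpos u)).ne'
    simp only [hr]
    nth_rewrite 3 [← h1]
    field_simp
  have hrrc : ContDiffAt ℝ 2 (fun u => r u * r u) 0 := hrc.mul hrc
  have hrd : ∀ α, pd α r 0 = 0 := by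
    intro α
    have hd := hrc.differentiableAt (by simp)
    have h := pd_mul α (hrrc.differentiableAt (by simp)) (hgc.differentiableAt (by simp))
    rw [hrr, pd_const, pd_mul α hd hd, hgd, hr0, hg0] at h
    linarith
  have hrdd : ∀ α, pd α (fun v => pd α r v) 0 = - κ α ^ 2 := by
    intro α
    have h := pd2_mul α hrrc hgc
    rw [hrr, pd2_const, pd2_mul α hrc hrc, hgdd, hgd, hrd, hr0, hg0] at h
    linarith
  obtain ⟨w, hw⟩ : ∃ w : Fin m → Fin m → (Fin m → ℝ) → ℝ, w = fun i j u =>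
      -(pd i (fun v => pd j f v) u * r u * (r u * r u)) := ⟨_, rfl⟩
  have hwc : ∀ i j, ContDiffAt ℝ 2 (w i j) 0 := by
    intro i j
    rw [hw]
    exact (((hF2 i j).mul hrc).mul hrrc).neg
  have hw0 : ∀ i j, w i j 0 = -(if i = j then κ i else 0) := by
    intro i j
    simp only [hw, hK, hr0]
    ring
  have hH' : H = fun u => ∑ i, ∑ j, ((if i = j then (1:ℝ) else 0) *
      (pd i (fun v => pd j f v) u * r u) + (pd i f u * pd j f u) * w i j u) := by
    funext u
    rw [hH u]
    refine Finset.sum_congr rfl fun i _ => Finset.sum_congr rfl fun j _ => ?_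
    have h1 : (r u * r u) = (g u)⁻¹ := eq_inv_of_mul_eq_one_left (congrFun hrr u)
    have h2 : (Real.sqrt (g u))⁻¹ = r u := by rw [hr]
    simp only [hw, h1]
    rw [div_eq_mul_inv _ (Real.sqrt _), h2]
    ring
  have hA : ∀ i j, ContDiffAt ℝ 2 (fun u => (pd i (fun v => pd j f v) u * r u)) 0 :=
    fun i j => (hF2 i j).mul hrc
  have hA' : ∀ i j, ContDiffAt ℝ 2 (fun u => (if i = j then (1:ℝ) else 0) *
      (pd i (fun v => pd j f v) u * r u)) 0 := fun i j => contDiffAt_const.mul (hA i j)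
  have hB : ∀ i j, ContDiffAt ℝ 2 (fun u => pd i f u * pd j f u) 0 :=
    fun i j => (hF1 i).mul (hF1 j)
  have hB' : ∀ i j, ContDiffAt ℝ 2 (fun u => (pd i f u * pd j f u) * w i j u) 0 :=
    fun i j => (hB i j).mul (hwc i j)
  have hT := fun i j => (hA' i j).add (hB' i j)
  have key : ∀ α, pd α (fun v => pd α H v) 0
      = (∑ i, pd α (fun v => pd α (fun w => pd i (fun w' => pd i f w') w) v) 0)
        - (∑ i, κ i) * κ α ^ 2 - 2 * κ α ^ 3 := by
    intro α
    have hd := fun i => (hF1 i).differentiableAt (by simp)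
    rw [hH', pd2_sum α _ fun i _ => ContDiffAt.sum fun j _ => hT i j]
    have e : ∀ i j, pd α (fun v => pd α (fun u => (if i = j then (1:ℝ) else 0) *
        (pd i (fun v => pd j f v) u * r u) + (pd i f u * pd j f u) * w i j u) v) 0
        = (if i = j then (pd α (fun v => pd α (fun w => pd i (fun w' => pd i f w') w) v) 0
            - κ i * κ α ^ 2) - (if α = i then 2 * κ α ^ 3 else 0) else 0) := by
      intro i j
      rw [pd2_add α (hA' i j) (hB' i j), pd2_mul α contDiffAt_const (hA i j), pd2_const,
        pd_const, pd2_mul α (hF2 i j) hrc, pd2_mul α (hB i j) (hwc i j),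
        pd2_mul α (hF1 i) (hF1 j), pd_mul α (hd i) (hd j)]
      simp only [hrd, hrdd, hr0, hw0, hK, hdf0]
      by_cases hij : i = j
      · subst hij
        by_cases ha : α = i
        · subst ha
          simp
          ring
        · simp [ha]
          ring
      · simp [hij]
    have e2 : ∀ i, pd α (fun v => pd α (fun u => ∑ j, ((if i = j then (1:ℝ) else 0) *
        (pd i (fun v => pd j f v) u * r u) + (pd i f u * pd j f u) * w i j u)) v) 0
        = (pd α (fun v => pd α (fun w => pd i (fun w' => pd i f w') w) v) 0
            - κ i * κ α ^ 2) - (if α = i then 2 * κ α ^ 3 else 0) := by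
      intro i
      rw [pd2_sum α _ fun j _ => hT i j, Finset.sum_congr rfl fun j _ => e i j]
      simp
    rw [Finset.sum_congr rfl fun i _ => e2 i]
    simp [Finset.sum_sub_distrib, Finset.sum_mul]
  rw [Finset.sum_congr rfl fun α _ => key α, Finset.sum_sub_distrib, Finset.sum_sub_distrib,
    Finset.sum_comm, ← Finset.mul_sum, ← Finset.mul_sum]
end

section
/- For real numbers κ₁, κ₂, κ₃, κ₄, define q(κ₁,κ₂,κ₃,κ₄) = (1/2)·Σ (κ_i − κ_j)²(κ_i − κ_k)(κ_i − κ_l), the sum taken over all 24 permutations (i,j,k,l) of (1,2,3,4). Then q(κ₁,κ₂,κ₃,κ₄) ≥ 0 for all real κ₁, …, κ₄, and q(κ₁,κ₂,κ₃,κ₄) = 0 if and only if the κ_i form two equal pairs, i.e. there exists a permutation σ of {1,2,3,4} with κ_{σ(1)} = κ_{σ(2)} and κ_{σ(3)} = κ_{σ(4)}. -/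
/-- The Möbius invariant principal curvature energy integrand:
`q(κ₁,κ₂,κ₃,κ₄) = (1/2)·Σ (κᵢ − κⱼ)²(κᵢ − κₖ)(κᵢ − κₗ)`, summed over all 24
permutations `(i,j,k,l)` of `(1,2,3,4)`. -/
noncomputable def qPCE (κ : Fin 4 → ℝ) : ℝ :=
  (1/2) * ∑ σ : Equiv.Perm (Fin 4),
    (κ (σ 0) - κ (σ 1))^2 * (κ (σ 0) - κ (σ 2)) * (κ (σ 0) - κ (σ 3))

theorem qPCE_formula (κ : Fin 4 → ℝ) :
    qPCE κ = ((κ 0 - κ 1)^2 - (κ 2 - κ 3)^2)^2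
      + 2 * (κ 0 + κ 1 - κ 2 - κ 3)^2 * ((κ 0 - κ 1)^2 + (κ 2 - κ 3)^2) := by
  have e2 : (2 : Fin 4) = Fin.succ 1 := rfl
  have e3 : (3 : Fin 4) = Fin.succ 2 := rfl
  have e1 : (1 : Fin 4) = Fin.succ 0 := rfl
  have f2 : (2 : Fin 3) = Fin.succ 1 := rfl
  have f1 : (1 : Fin 3) = Fin.succ 0 := rfl
  have g1 : (1 : Fin 2) = Fin.succ 0 := rfl
  unfold qPCE
  simp only [Finset.univ_perm_fin_succ, Finset.sum_map, ← Finset.univ_product_univ,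
    Finset.sum_product, Fin.sum_univ_succ, Equiv.coe_toEmbedding, Finset.univ_unique,
    Finset.sum_singleton, e1, e2, e3, Equiv.Perm.decomposeFin_symm_apply_zero,
    Equiv.Perm.decomposeFin_symm_apply_succ, f1, f2, g1]
  simp [Equiv.swap_apply_def, Fin.ext_iff]
  ring

theorem qPCE_perm (κ : Fin 4 → ℝ) (σ : Equiv.Perm (Fin 4)) :
    qPCE (fun i => κ (σ i)) = qPCE κ := by
  unfold qPCE
  congr 1
  exact Equiv.sum_comp (Equiv.mulLeft σ) (fun τ : Equiv.Perm (Fin 4) =>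
    (κ (τ 0) - κ (τ 1))^2 * (κ (τ 0) - κ (τ 2)) * (κ (τ 0) - κ (τ 3)))

theorem stmt7 (κ : Fin 4 → ℝ) :
    0 ≤ qPCE κ ∧
      (qPCE κ = 0 ↔ ∃ σ : Equiv.Perm (Fin 4), κ (σ 0) = κ (σ 1) ∧ κ (σ 2) = κ (σ 3)) := by
  refine ⟨by rw [qPCE_formula]; positivity, ?_, ?_⟩
  · intro h
    rw [qPCE_formula] at h
    obtain ⟨h1, h2⟩ := (add_eq_zero_iff_of_nonneg (by positivity) (by positivity)).1 h
    have h3 : (κ 0 - κ 1)^2 = (κ 2 - κ 3)^2 := sub_eq_zero.1 (pow_eq_zero_iff two_ne_zero |>.1 h1)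
    rcases mul_eq_zero.1 h2 with h4 | h4
    · have h5 : κ 0 + κ 1 - κ 2 - κ 3 = 0 := by simpa using h4
      rcases sq_eq_sq_iff_eq_or_eq_neg.1 h3 with h6 | h6
      · refine ⟨Equiv.swap 1 2, ?_, ?_⟩
        · rw [show (Equiv.swap 1 2 : Equiv.Perm (Fin 4)) 0 = 0 by decide,
            show (Equiv.swap 1 2 : Equiv.Perm (Fin 4)) 1 = 2 by decide]; linarith
        · rw [show (Equiv.swap 1 2 : Equiv.Perm (Fin 4)) 2 = 1 by decide,
            show (Equiv.swap 1 2 : Equiv.Perm (Fin 4)) 3 = 3 by decide]; linarith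
      · refine ⟨Equiv.swap 1 3, ?_, ?_⟩
        · rw [show (Equiv.swap 1 3 : Equiv.Perm (Fin 4)) 0 = 0 by decide,
            show (Equiv.swap 1 3 : Equiv.Perm (Fin 4)) 1 = 3 by decide]; linarith
        · rw [show (Equiv.swap 1 3 : Equiv.Perm (Fin 4)) 2 = 2 by decide,
            show (Equiv.swap 1 3 : Equiv.Perm (Fin 4)) 3 = 1 by decide]; linarith
    · have h5 : (κ 0 - κ 1)^2 = 0 := by linarith
      have h6 : (κ 2 - κ 3)^2 = 0 := by linarith
      exact ⟨1, sub_eq_zero.1 (pow_eq_zero_iff two_ne_zero |>.1 h5),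
        sub_eq_zero.1 (pow_eq_zero_iff two_ne_zero |>.1 h6)⟩
  · rintro ⟨σ, h1, h2⟩
    rw [← qPCE_perm κ σ, qPCE_formula]
    simp only [h1, h2]
    ring
end

section
/- For real numbers κ₁, κ₂, κ₃, κ₄, define W(κ₁,κ₂,κ₃,κ₄) = (1/6)·Σ (κ_i − κ_j)(κ_j − κ_k)(κ_k − κ_l)(κ_l − κ_i), the sum taken over all 24 permutations (i,j,k,l) of (1,2,3,4). Then W(κ₁,κ₂,κ₃,κ₄) ≥ 0 for all real κ₁, …, κ₄, and W(κ₁,κ₂,κ₃,κ₄) = 0 if and only if at least three of the numbers κ₁, κ₂, κ₃, κ₄ are equal. -/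
/-- The squared norm of the Weyl tensor of a 4-dimensional hypersurface in `ℝ⁵`, as a
symmetric polynomial of the principal curvatures:
`W(κ₁,κ₂,κ₃,κ₄) = (1/6)·Σ (κᵢ − κⱼ)(κⱼ − κₖ)(κₖ − κₗ)(κₗ − κᵢ)`, summed over all 24
permutations `(i,j,k,l)` of `(1,2,3,4)`. -/
noncomputable def WeylSq (κ : Fin 4 → ℝ) : ℝ :=
  (1/6) * ∑ σ : Equiv.Perm (Fin 4),
    (κ (σ 0) - κ (σ 1)) * (κ (σ 1) - κ (σ 2)) * (κ (σ 2) - κ (σ 3)) * (κ (σ 3) - κ (σ 0))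

theorem WeylSq_eq_aux (κ : Fin 4 → ℝ) : WeylSq κ = (2/3) *
    (((κ 0 - κ 1) * (κ 2 - κ 3))^2 + ((κ 0 - κ 2) * (κ 3 - κ 1))^2
      + ((κ 0 - κ 3) * (κ 1 - κ 2))^2) := by
  unfold WeylSq
  have e1 : ∀ f : Equiv.Perm (Fin 4) → ℝ, ∑ σ, f σ =
      ∑ p : Fin 4 × Fin 3 × Fin 2, f (Equiv.Perm.decomposeFin.symm (p.1,
        Equiv.Perm.decomposeFin.symm (p.2.1, Equiv.Perm.decomposeFin.symm (p.2.2, 1)))) := by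
    intro f
    symm
    apply Fintype.sum_bijective (fun p : Fin 4 × Fin 3 × Fin 2 =>
      (Equiv.Perm.decomposeFin.symm (p.1,
        Equiv.Perm.decomposeFin.symm (p.2.1, Equiv.Perm.decomposeFin.symm (p.2.2, 1)))
          : Equiv.Perm (Fin 4)))
    · rw [Fintype.bijective_iff_injective_and_card]
      refine ⟨?_, by simp [Fintype.card_perm, Nat.factorial]⟩
      rintro ⟨a, b, c⟩ ⟨a', b', c'⟩ h
      simpa only [EmbeddingLike.apply_eq_iff_eq, Prod.mk.injEq, and_true] using h
    · intro _; rfl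
  rw [e1]
  simp only [Fintype.sum_prod_type, Fin.sum_univ_succ, Fin.sum_univ_zero]
  have k0 : ∀ (a : Fin 4) (b : Fin 3) (c : Fin 2),
    (Equiv.Perm.decomposeFin.symm (a, Equiv.Perm.decomposeFin.symm (b,
      Equiv.Perm.decomposeFin.symm (c, (1 : Equiv.Perm (Fin 1))))) : Equiv.Perm (Fin 4)) 0
      = a := by decide
  have k1 : ∀ (a : Fin 4) (b : Fin 3) (c : Fin 2),
    (Equiv.Perm.decomposeFin.symm (a, Equiv.Perm.decomposeFin.symm (b,
      Equiv.Perm.decomposeFin.symm (c, (1 : Equiv.Perm (Fin 1))))) : Equiv.Perm (Fin 4)) 1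
      = Equiv.swap 0 a (Fin.succ b) := by decide
  have k2 : ∀ (a : Fin 4) (b : Fin 3) (c : Fin 2),
    (Equiv.Perm.decomposeFin.symm (a, Equiv.Perm.decomposeFin.symm (b,
      Equiv.Perm.decomposeFin.symm (c, (1 : Equiv.Perm (Fin 1))))) : Equiv.Perm (Fin 4)) 2
      = Equiv.swap 0 a (Fin.succ (Equiv.swap 0 b (Fin.succ c))) := by decide
  have k3 : ∀ (a : Fin 4) (b : Fin 3) (c : Fin 2),
    (Equiv.Perm.decomposeFin.symm (a, Equiv.Perm.decomposeFin.symm (b,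
      Equiv.Perm.decomposeFin.symm (c, (1 : Equiv.Perm (Fin 1))))) : Equiv.Perm (Fin 4)) 3
      = Equiv.swap 0 a (Fin.succ (Equiv.swap 0 b (Fin.succ (Equiv.swap 0 c 1)))) := by decide
  simp only [k0, k1, k2, k3]
  simp [Equiv.swap_apply_def, Fin.ext_iff]
  ring

theorem stmt8 (κ : Fin 4 → ℝ) :
    0 ≤ WeylSq κ ∧
      (WeylSq κ = 0 ↔ ∃ σ : Equiv.Perm (Fin 4), κ (σ 0) = κ (σ 1) ∧ κ (σ 1) = κ (σ 2)) := by
  rw [WeylSq_eq_aux]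
  refine ⟨by positivity, ?_, ?_⟩
  · intro h
    have hX : (κ 0 - κ 1) * (κ 2 - κ 3) = 0 := by
      apply pow_eq_zero_iff (two_ne_zero) |>.1
      nlinarith [sq_nonneg ((κ 0 - κ 1) * (κ 2 - κ 3)), sq_nonneg ((κ 0 - κ 2) * (κ 3 - κ 1)), sq_nonneg ((κ 0 - κ 3) * (κ 1 - κ 2))]
    have hY : (κ 0 - κ 2) * (κ 3 - κ 1) = 0 := by
      apply pow_eq_zero_iff (two_ne_zero) |>.1
      nlinarith [sq_nonneg ((κ 0 - κ 1) * (κ 2 - κ 3)), sq_nonneg ((κ 0 - κ 2) * (κ 3 - κ 1)), sq_nonneg ((κ 0 - κ 3) * (κ 1 - κ 2))]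
    have hZ : (κ 0 - κ 3) * (κ 1 - κ 2) = 0 := by
      rw [hX, hY] at h
      simpa using h
    have A : (κ 0 = κ 1 ∧ κ 1 = κ 2) ∨ (κ 0 = κ 1 ∧ κ 1 = κ 3) ∨ (κ 0 = κ 3 ∧ κ 3 = κ 2) ∨
        (κ 3 = κ 1 ∧ κ 1 = κ 2) := by
      simp only [mul_eq_zero, sub_eq_zero] at hX hY hZ
      grind
    rcases A with A | A | A | A
    · exact ⟨1, A⟩
    · exact ⟨Equiv.swap 2 3, A⟩
    · exact ⟨Equiv.swap 1 3, A⟩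
    · exact ⟨Equiv.swap 0 3, A⟩
  · rintro ⟨σ, h1, h2⟩
    have inj : σ 0 ≠ σ 1 ∧ σ 1 ≠ σ 2 ∧ σ 0 ≠ σ 2 := by
      refine ⟨?_, ?_, ?_⟩ <;> simp
    generalize σ 0 = i at *
    generalize σ 1 = j at *
    generalize σ 2 = k at *
    obtain ⟨a, b, c⟩ := inj
    fin_cases i <;> fin_cases j <;> fin_cases k <;> simp at a b c h1 h2 <;>
      simp [h1, h2]
end

section
/- For every real number a > 0, ∫₀^π [ a³ sin²θ ( 4(a²−1)² sin⁴θ + 10(a²−1) sin²θ + 5 ) ] / ( a² sin²θ + cos²θ )⁴ dθ = 5π(7a⁴ + 2a² − 1)/(16 a⁴). -/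
open Real

lemma aux_phi (a : ℝ) (ha : 0 < a) (x : ℝ) :
    HasDerivAt (fun θ : ℝ => θ + arctan ((a - 1) * (sin θ * cos θ) / (cos θ ^ 2 + a * sin θ ^ 2)))
      (a / (a ^ 2 * sin x ^ 2 + cos x ^ 2)) x := by
  have h := sin_sq_add_cos_sq x
  have hs := hasDerivAt_sin x
  have hc := hasDerivAt_cos x
  have pos : ∀ b : ℝ, 0 < b → 0 < cos x ^ 2 + b * sin x ^ 2 := by
    intro b hb
    rcases eq_or_ne (sin x) 0 with h0 | h0
    · have : cos x ^ 2 = 1 := by rw [h0] at h; linarith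
      rw [h0, this]; norm_num
    · positivity
  have hd := pos a ha
  have hD := pos (a ^ 2) (by positivity)
  have key := (hasDerivAt_id x).add
    ((((hs.mul hc).const_mul (a - 1)).div ((hc.pow 2).add ((hs.pow 2).const_mul a)) hd.ne').arctan)
  refine key.congr_deriv ?_
  simp only [Pi.mul_apply, Pi.add_apply, Pi.pow_apply, Pi.div_apply]
  generalize sin x = s at *
  generalize cos x = c at *
  have hE : 1 + ((a - 1) * (s * c) / (c ^ 2 + a * s ^ 2)) ^ 2
      = (c ^ 2 + a ^ 2 * s ^ 2) / (c ^ 2 + a * s ^ 2) ^ 2 := by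
    field_simp
    linear_combination (c ^ 2 + a ^ 2 * s ^ 2) * h
  rw [hE, add_comm (a ^ 2 * s ^ 2)]
  field_simp
  have hc2 : c ^ 2 = 1 - s ^ 2 := by linarith
  simp only [Nat.cast_ofNat, Nat.add_one_sub_one, pow_one]
  linear_combination ((a-1)*(c^2-a*s^2) + a) * h

lemma aux_rat (a p q r : ℝ) (ha : 0 < a) (x : ℝ) :
    HasDerivAt (fun θ : ℝ => (p * (a * sin θ) * cos θ ^ 5 + q * (a * sin θ) ^ 3 * cos θ ^ 3
        + r * (a * sin θ) ^ 5 * cos θ) / (a ^ 2 * sin θ ^ 2 + cos θ ^ 2) ^ 3)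
      (a * ((p * cos x ^ 4 + 3 * q * (a * sin x) ^ 2 * cos x ^ 2 + 5 * r * (a * sin x) ^ 4)
        * (a ^ 2 * sin x ^ 2 + cos x ^ 2) - 6 * (a * sin x) ^ 2 *
        (p * cos x ^ 4 + q * (a * sin x) ^ 2 * cos x ^ 2 + r * (a * sin x) ^ 4))
        / (a ^ 2 * sin x ^ 2 + cos x ^ 2) ^ 4) x := by
  have h := sin_sq_add_cos_sq x
  have hs := hasDerivAt_sin x
  have hc := hasDerivAt_cos x
  have hD : 0 < a ^ 2 * sin x ^ 2 + cos x ^ 2 := by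
    rcases eq_or_ne (sin x) 0 with h0 | h0
    · have : cos x ^ 2 = 1 := by rw [h0] at h; linarith
      rw [h0, this]; norm_num
    · positivity
  have hu := hs.const_mul a
  have key := (((((hu.const_mul p).mul (hc.pow 5)).add
    (((hu.pow 3).const_mul q).mul (hc.pow 3))).add
    (((hu.pow 5).const_mul r).mul hc))).div
    ((((hs.pow 2).const_mul (a ^ 2)).add (hc.pow 2)).pow 3) (pow_pos hD 3).ne'
  refine key.congr_deriv ?_
  simp only [Pi.mul_apply, Pi.add_apply, Pi.pow_apply, Pi.div_apply]
  generalize sin x = s at *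
  generalize cos x = c at *
  field_simp
  simp only [Nat.cast_ofNat, Nat.add_one_sub_one, pow_one]
  norm_num
  have e : s ^ 2 = 1 - c ^ 2 := by linarith
  grind

theorem stmt12 (a : ℝ) (ha : 0 < a) :
    ∫ θ in (0:ℝ)..π,
        a ^ 3 * sin θ ^ 2 *
            (4 * (a ^ 2 - 1) ^ 2 * sin θ ^ 4 + 10 * (a ^ 2 - 1) * sin θ ^ 2 + 5) /
          (a ^ 2 * sin θ ^ 2 + cos θ ^ 2) ^ 4
      = 5 * π * (7 * a ^ 4 + 2 * a ^ 2 - 1) / (16 * a ^ 4) := by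
  have pos : ∀ x : ℝ, 0 < a ^ 2 * sin x ^ 2 + cos x ^ 2 := by
    intro x
    have h := sin_sq_add_cos_sq x
    rcases eq_or_ne (sin x) 0 with h0 | h0
    · have : cos x ^ 2 = 1 := by rw [h0] at h; linarith
      rw [h0, this]; norm_num
    · positivity
  obtain ⟨α, hα⟩ : ∃ α : ℝ, α = 5 * (7 * a ^ 4 + 2 * a ^ 2 - 1) / (16 * a ^ 4) := ⟨_, rfl⟩
  have hα' : 16 * a ^ 4 * α = 5 * (7 * a ^ 4 + 2 * a ^ 2 - 1) := by
    rw [hα]; field_simp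
  rw [intervalIntegral.integral_eq_sub_of_hasDerivAt (fun x _ =>
    (((aux_phi a ha x).const_mul α).add
      (aux_rat a (-α) ((5 - 8 * α) / 3) ((15 - 11 * α) / 5) ha x)).congr_deriv ?_)]
  · simp
    rw [hα]; ring
  · apply Continuous.intervalIntegrable
    exact Continuous.div (by fun_prop) (by fun_prop) (fun x => (pow_pos (pos x) 4).ne')
  · have hD := pos x
    have h := sin_sq_add_cos_sq x
    generalize sin x = s at *
    generalize cos x = c at *
    have e : (1 : ℝ) = s ^ 2 + c ^ 2 := by linarith
    have e5 : (4 * (a ^ 2 - 1) ^ 2 * s ^ 4 + 10 * (a ^ 2 - 1) * s ^ 2 + 5)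
       = 4 * (a ^ 2 - 1) ^ 2 * s ^ 4 + 10 * (a ^ 2 - 1) * s ^ 2 * (s ^ 2 + c ^ 2)
         + 5 * (s ^ 2 + c ^ 2) ^ 2 := by rw [← e]; ring
    rw [e5]
    field_simp
    linear_combination (3 * a ^ 2 * s ^ 6) * hα'
end

section
/- For every real number a > 0, ∫₀^π [ a³ sin²θ ( 3(a²−1) sin²θ − a² + 2 ) / ( (a² cos²θ + sin²θ)³ (a² sin²θ + cos²θ)⁴ ) ] · ( 4(a²−1)⁴ sin⁸θ − 2(a²−1)³(4a²−15) sin⁶θ + (a²−1)²(4a⁴−40a²+65) sin⁴θ + 10(a²−1)(a²−2)(a²−3) sin²θ + 5(a²−2)² ) dθ = π(13a¹⁰ + 153a⁸ + 138a⁶ + 18a⁴ − 7a² + 5)/(16 a⁴ (a²+1)³). -/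
open Real

lemma aux_D (a : ℝ) (ha : 0 < a) (t : ℝ) : 0 < a ^ 2 * cos t ^ 2 + sin t ^ 2 := by
  have h := sin_sq_add_cos_sq t
  rcases eq_or_ne (cos t) 0 with h0 | h0
  · rw [h0] at h ⊢; nlinarith
  · positivity

lemma aux_E (a : ℝ) (ha : 0 < a) (t : ℝ) : 0 < a ^ 2 * sin t ^ 2 + cos t ^ 2 := by
  have h := sin_sq_add_cos_sq t
  rcases eq_or_ne (sin t) 0 with h0 | h0
  · rw [h0] at h ⊢; nlinarith
  · positivity

lemma aux_L (a : ℝ) (ha : 0 < a) (t : ℝ) : 0 < a * cos t ^ 2 + sin t ^ 2 := by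
  have := aux_D (√a) (Real.sqrt_pos.2 ha) t
  rwa [Real.sq_sqrt ha.le] at this

lemma aux_M (a : ℝ) (ha : 0 < a) (t : ℝ) : 0 < a * sin t ^ 2 + cos t ^ 2 := by
  have := aux_E (√a) (Real.sqrt_pos.2 ha) t
  rwa [Real.sq_sqrt ha.le] at this

lemma hd_D (a : ℝ) (ha : 0 < a) (t : ℝ) :
    HasDerivAt (fun t => t + arctan ((1 - a) * (sin t * cos t) / (a * cos t ^ 2 + sin t ^ 2)))
      (a / (a ^ 2 * cos t ^ 2 + sin t ^ 2)) t := by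
  have hL := aux_L a ha t
  have hD := aux_D a ha t
  have hs := hasDerivAt_sin t
  have hc := hasDerivAt_cos t
  have h := (hasDerivAt_id t).add ((((hs.mul hc).const_mul (1 - a)).div
    (((hc.pow 2).const_mul a).add (hs.pow 2)) hL.ne').arctan)
  refine h.congr_deriv ?_
  have h1 := sin_sq_add_cos_sq t
  simp only [Pi.add_apply, Pi.mul_apply, Pi.pow_apply, Pi.div_apply]
  have key : (a * cos t ^ 2 + sin t ^ 2) ^ 2 + ((1 - a) * (sin t * cos t)) ^ 2
      = a ^ 2 * cos t ^ 2 + sin t ^ 2 := by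
    have : sin t ^ 2 = 1 - cos t ^ 2 := by linarith
    rw [mul_pow, mul_pow, this]; ring
  have e : 1 + ((1 - a) * (sin t * cos t) / (a * cos t ^ 2 + sin t ^ 2)) ^ 2
      = (a ^ 2 * cos t ^ 2 + sin t ^ 2) / (a * cos t ^ 2 + sin t ^ 2) ^ 2 := by
    rw [← key]; field_simp
  rw [e]
  field_simp
  have : sin t ^ 2 = 1 - cos t ^ 2 := by linarith
  simp only [Nat.cast_ofNat]
  ring_nf
  have h4 : sin t ^ 4 = (1 - cos t ^ 2) ^ 2 := by rw [← this]; ring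
  simp only [this, h4]
  ring

lemma hd_E (a : ℝ) (ha : 0 < a) (t : ℝ) :
    HasDerivAt (fun t => t + arctan ((a - 1) * (sin t * cos t) / (a * sin t ^ 2 + cos t ^ 2)))
      (a / (a ^ 2 * sin t ^ 2 + cos t ^ 2)) t := by
  have hL := aux_M a ha t
  have hD := aux_E a ha t
  have hs := hasDerivAt_sin t
  have hc := hasDerivAt_cos t
  have h := (hasDerivAt_id t).add ((((hs.mul hc).const_mul (a - 1)).div
    (((hs.pow 2).const_mul a).add (hc.pow 2)) hL.ne').arctan)
  refine h.congr_deriv ?_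
  have h1 := sin_sq_add_cos_sq t
  simp only [Pi.add_apply, Pi.mul_apply, Pi.pow_apply, Pi.div_apply]
  have key : (a * sin t ^ 2 + cos t ^ 2) ^ 2 + ((a - 1) * (sin t * cos t)) ^ 2
      = a ^ 2 * sin t ^ 2 + cos t ^ 2 := by
    have : sin t ^ 2 = 1 - cos t ^ 2 := by linarith
    rw [mul_pow, mul_pow, this]; ring
  have e : 1 + ((a - 1) * (sin t * cos t) / (a * sin t ^ 2 + cos t ^ 2)) ^ 2
      = (a ^ 2 * sin t ^ 2 + cos t ^ 2) / (a * sin t ^ 2 + cos t ^ 2) ^ 2 := by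
    rw [← key]; field_simp
  rw [e]
  field_simp
  have : sin t ^ 2 = 1 - cos t ^ 2 := by linarith
  simp only [Nat.cast_ofNat]
  ring_nf
  have h4 : sin t ^ 4 = (1 - cos t ^ 2) ^ 2 := by rw [← this]; ring
  simp only [this, h4]
  ring

lemma hd_F (A p0 p1 p2 p3 p4 t : ℝ) (hD : A * cos t ^ 2 + sin t ^ 2 ≠ 0)
    (hE : A * sin t ^ 2 + cos t ^ 2 ≠ 0) :
    HasDerivAt (fun t => (sin t * cos t) *
        (p0 + p1 * sin t ^ 2 + p2 * sin t ^ 4 + p3 * sin t ^ 6 + p4 * sin t ^ 8) /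
        ((A * cos t ^ 2 + sin t ^ 2) ^ 2 * (A * sin t ^ 2 + cos t ^ 2) ^ 3))
      (((1 - 2 * sin t ^ 2) * (p0 + p1 * sin t ^ 2 + p2 * sin t ^ 4 + p3 * sin t ^ 6 + p4 * sin t ^ 8)
          * (A * cos t ^ 2 + sin t ^ 2) * (A * sin t ^ 2 + cos t ^ 2)
        + 2 * sin t ^ 2 * cos t ^ 2 *
          ((p1 + 2 * p2 * sin t ^ 2 + 3 * p3 * sin t ^ 4 + 4 * p4 * sin t ^ 6)
            * (A * cos t ^ 2 + sin t ^ 2) * (A * sin t ^ 2 + cos t ^ 2)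
          - 2 * (1 - A) * (p0 + p1 * sin t ^ 2 + p2 * sin t ^ 4 + p3 * sin t ^ 6 + p4 * sin t ^ 8)
            * (A * sin t ^ 2 + cos t ^ 2)
          - 3 * (A - 1) * (p0 + p1 * sin t ^ 2 + p2 * sin t ^ 4 + p3 * sin t ^ 6 + p4 * sin t ^ 8)
            * (A * cos t ^ 2 + sin t ^ 2))) /
        ((A * cos t ^ 2 + sin t ^ 2) ^ 3 * (A * sin t ^ 2 + cos t ^ 2) ^ 4)) t := by
  have hs := hasDerivAt_sin t
  have hc := hasDerivAt_cos t
  have hP : HasDerivAt (fun t => p0 + p1 * sin t ^ 2 + p2 * sin t ^ 4 + p3 * sin t ^ 6 + p4 * sin t ^ 8)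
      ((p1 + 2 * p2 * sin t ^ 2 + 3 * p3 * sin t ^ 4 + 4 * p4 * sin t ^ 6) * (2 * sin t * cos t)) t := by
    refine ((((((hs.pow 2).const_mul p1).const_add p0).add ((hs.pow 4).const_mul p2)).add
      ((hs.pow 6).const_mul p3)).add ((hs.pow 8).const_mul p4)).congr_deriv ?_
    push_cast
    ring
  have hD' : HasDerivAt (fun t => A * cos t ^ 2 + sin t ^ 2) ((1 - A) * (2 * sin t * cos t)) t := by
    refine (((hc.pow 2).const_mul A).add (hs.pow 2)).congr_deriv ?_
    push_cast
    ring
  have hE' : HasDerivAt (fun t => A * sin t ^ 2 + cos t ^ 2) ((A - 1) * (2 * sin t * cos t)) t := by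
    refine (((hs.pow 2).const_mul A).add (hc.pow 2)).congr_deriv ?_
    push_cast
    ring
  have hsc : HasDerivAt (fun t => sin t * cos t) (1 - 2 * sin t ^ 2) t := by
    refine (hs.mul hc).congr_deriv ?_
    have h1 := sin_sq_add_cos_sq t
    linear_combination h1
  have h := (hsc.mul hP).div ((hD'.pow 2).mul (hE'.pow 3))
    (mul_ne_zero (pow_ne_zero 2 hD) (pow_ne_zero 3 hE))
  refine h.congr_deriv ?_
  simp only [Pi.mul_apply, Pi.pow_apply, Nat.cast_ofNat]
  generalize A * cos t ^ 2 + sin t ^ 2 = D at *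
  generalize A * sin t ^ 2 + cos t ^ 2 = E at *
  generalize p0 + p1 * sin t ^ 2 + p2 * sin t ^ 4 + p3 * sin t ^ 6 + p4 * sin t ^ 8 = P at *
  field_simp
  ring

lemma alg (A s c : ℝ) (hA : 0 < A) (hA1 : A - 1 ≠ 0) (hc : c = 1 - s) (hD : A * c + s ≠ 0)
    (hE : A * s + c ≠ 0) (p0 p1 p2 p3 p4 k1 k2 : ℝ)
    (h0 : p0 = (-5 - 68*A - 110*A^2 - 28*A^3 + 35*A^4) / (16 * A * (A+1)^2))
    (h1 : p1 = (-30 + 372*A + 596*A^2 - 192*A^3 - 574*A^4 - 372*A^5 + 200*A^6)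
      / (48 * A^2 * (A+1)^2))
    (h2 : p2 = (-15 + 126*A - 956*A^2 + 24*A^3 + 1828*A^4 - 498*A^5 - 368*A^6 - 228*A^7 + 87*A^8)
      / (48 * A^3 * (A+1)^2))
    (h3 : p3 = (30 - 202*A + 952*A^2 - 766*A^3 - 1592*A^4 + 2186*A^5 - 224*A^6 - 450*A^7 + 66*A^8)
      / (48 * A^3 * (A+1)^2))
    (h4 : p4 = (-15 + 106*A - 386*A^2 + 410*A^3 + 472*A^4 - 1138*A^5 + 466*A^6 + 238*A^7 - 153*A^8)
      / (48 * A^3 * (A+1)^2))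
    (hk1 : k1 = (-80 - 160*A + 160*A^3 + 48*A^4) / (16 * A * (A+1)^3 * (A-1)))
    (hk2 : k2 = (-5 + 12*A + 55*A^2 + 40*A^3 - 15*A^4 - 20*A^5 - 35*A^6)
      / (16 * A^3 * (A+1)^3 * (A-1))) :
    ((1 - 2 * s) * (p0 + p1 * s + p2 * s^2 + p3 * s^3 + p4 * s^4) * (A * c + s) * (A * s + c)
      + 2 * s * c * ((p1 + 2 * p2 * s + 3 * p3 * s^2 + 4 * p4 * s^3) * (A * c + s) * (A * s + c)
        - 2 * (1 - A) * (p0 + p1 * s + p2 * s^2 + p3 * s^3 + p4 * s^4) * (A * s + c)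
        - 3 * (A - 1) * (p0 + p1 * s + p2 * s^2 + p3 * s^3 + p4 * s^4) * (A * c + s)))
      / ((A * c + s)^3 * (A * s + c)^4) + k1 / (A * c + s) + k2 / (A * s + c)
    = s * (3 * (A - 1) * s - A + 2) / ((A * c + s)^3 * (A * s + c)^4) *
      (4 * (A - 1)^4 * s^4 - 2 * (A - 1)^3 * (4 * A - 15) * s^3
        + (A - 1)^2 * (4 * A^2 - 40 * A + 65) * s^2 + 10 * (A - 1) * (A - 2) * (A - 3) * s
        + 5 * (A - 2)^2) := by
  have e1 : k1 / (A * c + s) = k1 * (A * c + s)^2 * (A * s + c)^4 / ((A * c + s)^3 * (A * s + c)^4) := by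
    field_simp
  have e2 : k2 / (A * s + c) = k2 * (A * c + s)^3 * (A * s + c)^3 / ((A * c + s)^3 * (A * s + c)^4) := by
    field_simp
  rw [e1, e2, ← add_div, ← add_div, div_mul_eq_mul_div]
  congr 1
  have hA0 : A ≠ 0 := hA.ne'
  have hA2 : A + 1 ≠ 0 := by positivity
  clear e1 e2 hD hE
  subst hc h0 h1 h2 h3 h4 hk1 hk2
  field_simp
  ring

theorem stmt13 (a : ℝ) (ha : 0 < a) :
    ∫ θ in (0:ℝ)..π,
        (a ^ 3 * sin θ ^ 2 * (3 * (a ^ 2 - 1) * sin θ ^ 2 - a ^ 2 + 2) /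
            ((a ^ 2 * cos θ ^ 2 + sin θ ^ 2) ^ 3 * (a ^ 2 * sin θ ^ 2 + cos θ ^ 2) ^ 4)) *
          (4 * (a ^ 2 - 1) ^ 4 * sin θ ^ 8
            - 2 * (a ^ 2 - 1) ^ 3 * (4 * a ^ 2 - 15) * sin θ ^ 6
            + (a ^ 2 - 1) ^ 2 * (4 * a ^ 4 - 40 * a ^ 2 + 65) * sin θ ^ 4
            + 10 * (a ^ 2 - 1) * (a ^ 2 - 2) * (a ^ 2 - 3) * sin θ ^ 2
            + 5 * (a ^ 2 - 2) ^ 2)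
      = π * (13 * a ^ 10 + 153 * a ^ 8 + 138 * a ^ 6 + 18 * a ^ 4 - 7 * a ^ 2 + 5) /
          (16 * a ^ 4 * (a ^ 2 + 1) ^ 3) := by
  rcases eq_or_ne a 1 with rfl | ha1
  · have : ∀ θ : ℝ, ((1:ℝ) ^ 3 * sin θ ^ 2 * (3 * (1 ^ 2 - 1) * sin θ ^ 2 - 1 ^ 2 + 2) /
            ((1 ^ 2 * cos θ ^ 2 + sin θ ^ 2) ^ 3 * (1 ^ 2 * sin θ ^ 2 + cos θ ^ 2) ^ 4)) *
          (4 * (1 ^ 2 - 1) ^ 4 * sin θ ^ 8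
            - 2 * (1 ^ 2 - 1) ^ 3 * (4 * 1 ^ 2 - 15) * sin θ ^ 6
            + (1 ^ 2 - 1) ^ 2 * (4 * 1 ^ 4 - 40 * 1 ^ 2 + 65) * sin θ ^ 4
            + 10 * (1 ^ 2 - 1) * (1 ^ 2 - 2) * (1 ^ 2 - 3) * sin θ ^ 2
            + 5 * (1 ^ 2 - 2) ^ 2) = 5 * sin θ ^ 2 := by
      intro θ
      simp only [one_pow, one_mul, cos_sq_add_sin_sq, sin_sq_add_cos_sq]
      ring
    simp only [this]
    rw [intervalIntegral.integral_const_mul, integral_sin_sq]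
    simp
    ring
  have hA : 0 < a ^ 2 := by positivity
  have hA1 : a ^ 2 - 1 ≠ 0 := by
    have : a ^ 2 - 1 = (a - 1) * (a + 1) := by ring
    rw [this]
    exact mul_ne_zero (sub_ne_zero.2 ha1) (by positivity)
  obtain ⟨p0, h0⟩ : ∃ p, p = _ := ⟨_, rfl⟩
  obtain ⟨p1, h1⟩ : ∃ p, p = _ := ⟨_, rfl⟩
  obtain ⟨p2, h2⟩ : ∃ p, p = _ := ⟨_, rfl⟩
  obtain ⟨p3, h3⟩ : ∃ p, p = _ := ⟨_, rfl⟩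
  obtain ⟨p4, h4⟩ : ∃ p, p = _ := ⟨_, rfl⟩
  obtain ⟨k1, hk1⟩ : ∃ p, p = _ := ⟨_, rfl⟩
  obtain ⟨k2, hk2⟩ : ∃ p, p = _ := ⟨_, rfl⟩
  have key := fun t => alg (a ^ 2) (sin t ^ 2) (cos t ^ 2) hA hA1 (cos_sq' t)
    (aux_D a ha t).ne' (aux_E a ha t).ne' p0 p1 p2 p3 p4 k1 k2 h0 h1 h2 h3 h4 hk1 hk2
  rw [intervalIntegral.integral_eq_sub_of_hasDerivAt
    (f := fun t => a ^ 3 * ((sin t * cos t) *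
        (p0 + p1 * sin t ^ 2 + p2 * sin t ^ 4 + p3 * sin t ^ 6 + p4 * sin t ^ 8) /
        ((a ^ 2 * cos t ^ 2 + sin t ^ 2) ^ 2 * (a ^ 2 * sin t ^ 2 + cos t ^ 2) ^ 3))
      + a ^ 2 * k1 * (t + arctan ((1 - a) * (sin t * cos t) / (a * cos t ^ 2 + sin t ^ 2)))
      + a ^ 2 * k2 * (t + arctan ((a - 1) * (sin t * cos t) / (a * sin t ^ 2 + cos t ^ 2))))]
  · simp only [sin_pi, sin_zero, zero_mul, mul_zero, zero_div, arctan_zero, add_zero, zero_add,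
      sub_zero]
    rw [hk1, hk2]
    field_simp
    ring
  · intro t _
    refine ((((hd_F (a ^ 2) p0 p1 p2 p3 p4 t (aux_D a ha t).ne' (aux_E a ha t).ne').const_mul
      (a ^ 3)).add ((hd_D a ha t).const_mul (a ^ 2 * k1))).add
      ((hd_E a ha t).const_mul (a ^ 2 * k2))).congr_deriv ?_
    have := congrArg (fun x => a ^ 3 * x) (key t)
    simp only [← pow_mul] at this
    norm_num only at this
    refine Eq.trans (Eq.trans ?_ this) ?_
    · ring
    · ring
  · apply Continuous.intervalIntegrable
    have c1 : ∀ t, (a ^ 2 * cos t ^ 2 + sin t ^ 2) ^ 3 * (a ^ 2 * sin t ^ 2 + cos t ^ 2) ^ 4 ≠ 0 :=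
      fun t => mul_ne_zero (pow_ne_zero _ (aux_D a ha t).ne') (pow_ne_zero _ (aux_E a ha t).ne')
    fun_prop (disch := exact c1)
end

section
/- For every real number a > 1, 5(7a⁴ + 2a² − 1)/(16 a⁴) + (13a¹⁰ + 153a⁸ + 138a⁶ + 18a⁴ − 7a² + 5)/(16 a⁴ (a²+1)³) < 5. -/
theorem stmt14 (a : ℝ) (ha : 1 < a) :
    5 * (7 * a ^ 4 + 2 * a ^ 2 - 1) / (16 * a ^ 4)
      + (13 * a ^ 10 + 153 * a ^ 8 + 138 * a ^ 6 + 18 * a ^ 4 - 7 * a ^ 2 + 5) /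
          (16 * a ^ 4 * (a ^ 2 + 1) ^ 3) < 5 := by
  have h0 : 0 < a := by linarith
  have h1 : 0 < a ^ 2 - 1 := by nlinarith
  have h2 : 0 < 4 * a ^ 2 * (a ^ 2 - 1) ^ 2 * (8 * a ^ 4 + 9 * a ^ 2 + 3) /
      (16 * a ^ 4 * (a ^ 2 + 1) ^ 3) := by positivity
  have h3 : 5 - (5 * (7 * a ^ 4 + 2 * a ^ 2 - 1) / (16 * a ^ 4)
      + (13 * a ^ 10 + 153 * a ^ 8 + 138 * a ^ 6 + 18 * a ^ 4 - 7 * a ^ 2 + 5) /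
          (16 * a ^ 4 * (a ^ 2 + 1) ^ 3)) =
      4 * a ^ 2 * (a ^ 2 - 1) ^ 2 * (8 * a ^ 4 + 9 * a ^ 2 + 3) /
      (16 * a ^ 4 * (a ^ 2 + 1) ^ 3) := by
    have : a ^ 2 + 1 ≠ 0 := by positivity
    field_simp
    ring
  linarith
end

section
/- For every real number a > 1, writing A(θ) = a² sin²θ + cos²θ, the following definite integral identity holds: (π²/64) ∫₀^π [ a²/A(θ)⁶ ] · [ 9(a²−1)² sin²θ cos²θ (A(θ)+1)² + (135/16) a² (A(θ)+3)(A(θ)+1/3)²(A(θ)−1/5) ] · √(A(θ)) · sin³θ dθ = [π²/(17920 a⁶ (a²−1))] · ( 10613a⁸ − 7778a⁶ − 2376a⁴ − 16a² − 128 + 4725 a⁸ (a² − 16/15) · arctan(√(a²−1))/√(a²−1) ). -/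
open Real

theorem stmt15 (a : ℝ) (ha : 1 < a) (A : ℝ → ℝ)
    (hA : ∀ θ, A θ = a ^ 2 * sin θ ^ 2 + cos θ ^ 2) :
    (π ^ 2 / 64) *
        ∫ θ in (0:ℝ)..π,
          a ^ 2 / A θ ^ 6 *
              (9 * (a ^ 2 - 1) ^ 2 * sin θ ^ 2 * cos θ ^ 2 * (A θ + 1) ^ 2
                + (135 / 16) * a ^ 2 * (A θ + 3) * (A θ + 1 / 3) ^ 2 * (A θ - 1 / 5)) *
            Real.sqrt (A θ) * sin θ ^ 3
      = π ^ 2 / (17920 * a ^ 6 * (a ^ 2 - 1)) *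
          (10613 * a ^ 8 - 7778 * a ^ 6 - 2376 * a ^ 4 - 16 * a ^ 2 - 128
            + 4725 * a ^ 8 * (a ^ 2 - 16 / 15) *
                (arctan (Real.sqrt (a ^ 2 - 1)) / Real.sqrt (a ^ 2 - 1))) := by
  have hs : 1 < a ^ 2 := by nlinarith
  obtain ⟨q, hq, hq2⟩ : ∃ q, 0 < q ∧ q ^ 2 = a ^ 2 - 1 :=
    ⟨√(a ^ 2 - 1), by apply Real.sqrt_pos.2; linarith, Real.sq_sqrt (by linarith)⟩
  have hsq : √(a ^ 2 - 1) = q := by rw [← hq2, Real.sqrt_sq hq.le]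
  rw [hsq]
  have haq : a ^ 2 = q ^ 2 + 1 := by linarith
  have hApos : ∀ θ, 0 < A θ := by
    intro θ
    rw [hA, haq]
    nlinarith [sin_sq_add_cos_sq θ, mul_nonneg (sq_nonneg q) (sq_nonneg (sin θ))]
  have hAc : Continuous A := by
    have : A = fun θ => a ^ 2 * sin θ ^ 2 + cos θ ^ 2 := funext hA
    rw [this]; fun_prop
  have hA' : ∀ θ, HasDerivAt A (2 * q ^ 2 * sin θ * cos θ) θ := by
    intro θ
    have : A = fun θ => a ^ 2 * sin θ ^ 2 + cos θ ^ 2 := funext hA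
    rw [this]
    have h := (((hasDerivAt_sin θ).pow 2).const_mul (a ^ 2)).add ((hasDerivAt_cos θ).pow 2)
    refine h.congr_deriv ?_
    rw [haq]; push_cast; ring
  have hsin : ∀ θ, sin θ ^ 2 = (A θ - 1) / q ^ 2 := by
    intro θ
    rw [eq_div_iff (by positivity), hA, haq]
    linear_combination -sin_sq_add_cos_sq θ
  have hcos : ∀ θ, cos θ ^ 2 = (q ^ 2 + 1 - A θ) / q ^ 2 := by
    intro θ
    rw [eq_div_iff (by positivity), hA, haq]
    linear_combination (q ^ 2 + 1) * sin_sq_add_cos_sq θ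
  set t : ℝ → ℝ := fun θ => cos θ / √(A θ) with ht
  have ht' : ∀ θ, HasDerivAt t (-(sin θ * a ^ 2 / (A θ * √(A θ)))) θ := by
    intro θ
    have h := (hasDerivAt_cos θ).div ((hA' θ).sqrt (hApos θ).ne') (Real.sqrt_pos.2 (hApos θ)).ne'
    refine h.congr_deriv ?_
    have hr := Real.sqrt_pos.2 (hApos θ)
    have hr2 := Real.sq_sqrt (hApos θ).le
    have hc := hcos θ
    have hp := hApos θ
    rw [haq, hr2]
    set r := √(A θ)
    rw [eq_div_iff (by positivity)] at hc
    field_simp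
    rw [hr2]
    linear_combination (-sin θ) * hc
  have htt : ∀ θ, q ^ 2 * t θ ^ 2 = a ^ 2 / A θ - 1 := by
    intro θ
    have hp := hApos θ
    simp only [ht, div_pow]
    rw [Real.sq_sqrt hp.le, hcos, haq]
    field_simp
  -- primitive in t
  set G : ℝ → ℝ := fun x =>
    1 / q ^ 2 * ((135 / 16 * a ^ 4 - 9 * a ^ 2) * (arctan (q * x) / q) + 477 / 16 * a ^ 2 * x
      + (18 - 282 / 16 * a ^ 2) * (x + q ^ 2 * x ^ 3 / 3) / a ^ 2
      - 486 / 16 * a ^ 2 * (x + 2 * q ^ 2 * x ^ 3 / 3 + q ^ 4 * x ^ 5 / 5) / a ^ 4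
      + (3 / 16 * a ^ 2 - 9) * (x + q ^ 2 * x ^ 3 + 3 * q ^ 4 * x ^ 5 / 5 + q ^ 6 * x ^ 7 / 7) / a ^ 6
      + 153 / 16 * a ^ 2 * (x + 4 * q ^ 2 * x ^ 3 / 3 + 6 * q ^ 4 * x ^ 5 / 5 + 4 * q ^ 6 * x ^ 7 / 7
          + q ^ 8 * x ^ 9 / 9) / a ^ 8) with hG
  have hG' : ∀ x, HasDerivAt G (1 / q ^ 2 * ((135 / 16 * a ^ 4 - 9 * a ^ 2) * (1 / (1 + q ^ 2 * x ^ 2))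
      + 477 / 16 * a ^ 2
      + (18 - 282 / 16 * a ^ 2) * (1 + q ^ 2 * x ^ 2) / a ^ 2
      - 486 / 16 * a ^ 2 * (1 + q ^ 2 * x ^ 2) ^ 2 / a ^ 4
      + (3 / 16 * a ^ 2 - 9) * (1 + q ^ 2 * x ^ 2) ^ 3 / a ^ 6
      + 153 / 16 * a ^ 2 * (1 + q ^ 2 * x ^ 2) ^ 4 / a ^ 8)) x := by
    intro x
    have p : ∀ n : ℕ, HasDerivAt (fun x : ℝ => x ^ n) (n * x ^ (n - 1)) x := fun n => hasDerivAt_pow n x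
    have i := hasDerivAt_id' x
    have h0 := ((((i.const_mul q).arctan).div_const q).const_mul (135 / 16 * a ^ 4 - 9 * a ^ 2))
    have h1 := i.const_mul (477 / 16 * a ^ 2)
    have h2 := ((i.add (((p 3).const_mul (q ^ 2)).div_const 3)).const_mul
      (18 - 282 / 16 * a ^ 2)).div_const (a ^ 2)
    have h3 := (((i.add (((p 3).const_mul (2 * q ^ 2)).div_const 3)).add
      (((p 5).const_mul (q ^ 4)).div_const 5)).const_mul (486 / 16 * a ^ 2)).div_const (a ^ 4)
    have h4 := ((((i.add ((p 3).const_mul (q ^ 2))).add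
      (((p 5).const_mul (3 * q ^ 4)).div_const 5)).add
      (((p 7).const_mul (q ^ 6)).div_const 7)).const_mul (3 / 16 * a ^ 2 - 9)).div_const (a ^ 6)
    have h5 := (((((i.add (((p 3).const_mul (4 * q ^ 2)).div_const 3)).add
      (((p 5).const_mul (6 * q ^ 4)).div_const 5)).add
      (((p 7).const_mul (4 * q ^ 6)).div_const 7)).add
      (((p 9).const_mul (q ^ 8)).div_const 9)).const_mul (153 / 16 * a ^ 2)).div_const (a ^ 8)
    have h := (((((h0.add h1).add h2).sub h3).add h4).add h5).const_mul (1 / q ^ 2)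
    refine h.congr_deriv ?_
    have e : 1 / (1 + (q * x) ^ 2) * (q * 1) / q = 1 / (1 + q ^ 2 * x ^ 2) := by
      field_simp
    rw [e]
    push_cast
    ring
  have key : ∀ θ, HasDerivAt (fun θ => -G (t θ)) (a ^ 2 / A θ ^ 6 *
              (9 * (a ^ 2 - 1) ^ 2 * sin θ ^ 2 * cos θ ^ 2 * (A θ + 1) ^ 2
                + (135 / 16) * a ^ 2 * (A θ + 3) * (A θ + 1 / 3) ^ 2 * (A θ - 1 / 5)) *
            Real.sqrt (A θ) * sin θ ^ 3) θ := by
    intro θ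
    have h := ((hG' (t θ)).comp θ (ht' θ)).neg
    refine h.congr_deriv ?_
    have e : 1 + q ^ 2 * t θ ^ 2 = a ^ 2 / A θ := by rw [htt]; ring
    have e3 : sin θ ^ 3 = sin θ * ((A θ - 1) / q ^ 2) := by rw [← hsin]; ring
    rw [e, e3, hsin, hcos, ← hq2]
    have hp := hApos θ
    have hr := Real.sqrt_pos.2 hp
    have hr2 := Real.sq_sqrt hp.le
    set r := √(A θ)
    rw [← hr2, show q ^ 2 + 1 = a ^ 2 by linarith]
    have ha0 : 0 < a := by linarith
    field_simp
    ring
  rw [intervalIntegral.integral_eq_sub_of_hasDerivAt (fun θ _ => key θ)]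
  · have t0 : t 0 = 1 := by simp [ht, hA]
    have tpi : t π = -1 := by simp [ht, hA]
    rw [t0, tpi, ← hq2]
    simp only [hG, mul_neg, mul_one, arctan_neg]
    have ha0 : 0 < a := by linarith
    have e4 : a ^ 4 = (q ^ 2 + 1) ^ 2 := by rw [← haq]; ring
    have e6 : a ^ 6 = (q ^ 2 + 1) ^ 3 := by rw [← haq]; ring
    have e8 : a ^ 8 = (q ^ 2 + 1) ^ 4 := by rw [← haq]; ring
    rw [e4, e6, e8, haq]
    field_simp
    ring
  · apply Continuous.intervalIntegrable
    have hne : ∀ θ, A θ ^ 6 ≠ 0 := fun θ => pow_ne_zero _ (hApos θ).ne'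
    have := continuous_const.div (hAc.pow 6) hne (f := fun _ => a ^ 2)
    fun_prop (disch := assumption)
end

section
/- For every real number a > 1, writing A(θ) = a² sin²θ + cos²θ, the following definite integral identity holds: (π⁴/768) ∫₀^π [ 3a²(a²−1)² sin²θ / A(θ)⁶ ] · [ (a²−1)²(5a²−8) cos⁶θ + (−15a⁶ + 22a⁴ − 55a² + 48) cos⁴θ + (15a⁶ + 10a⁴ + 31a² − 8) cos²θ − 5a⁶ − 14a⁴ + 3a² ] · √(A(θ)) · sin³θ dθ = [π⁴/(40320 a⁶ (a²−1))] · ( 1241a⁸ − 1346a⁶ − 2232a⁴ + 1648a² − 256 − 1575 a⁸ (a² − 8/5) · arctan(√(a²−1))/√(a²−1) ). -/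
open Real

theorem hasDeriv_G (w p0 p1 p2 p3 p4 K v : ℝ) (hw : w ≠ 0) :
    HasDerivAt (fun v : ℝ => p0 * v + p1 * v ^ 3 / 3 + p2 * v ^ 5 / 5 + p3 * v ^ 7 / 7
      + p4 * v ^ 9 / 9 + K * (arctan (w * v) / w))
      (p0 + p1 * v ^ 2 + p2 * v ^ 4 + p3 * v ^ 6 + p4 * v ^ 8 + K / (1 + w ^ 2 * v ^ 2)) v := by
  have h (n : ℕ) (p d : ℝ) : HasDerivAt (fun v : ℝ => p * v ^ n / d)
      (p * (n * v ^ (n - 1)) / d) v := ((hasDerivAt_pow n v).const_mul p).div_const d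
  have h0 : HasDerivAt (fun v : ℝ => p0 * v) (p0 * 1) v := (hasDerivAt_id' v).const_mul p0
  have ha : HasDerivAt (fun v : ℝ => K * (arctan (w * v) / w))
      (K * ((1 / (1 + (w * v) ^ 2) * (w * 1)) / w)) v :=
    ((((hasDerivAt_id' v).const_mul w).arctan).div_const w).const_mul K
  have := ((((h0.add (h 3 p1 3)).add (h 5 p2 5)).add (h 7 p3 7)).add (h 9 p4 9)).add ha
  refine this.congr_deriv ?_
  have : (1 + w ^ 2 * v ^ 2) ≠ 0 := by positivity
  rw [mul_pow]
  field_simp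
  push_cast
  ring

theorem hasDeriv_v (a θ : ℝ) (hA : 0 < a ^ 2 * sin θ ^ 2 + cos θ ^ 2) :
    HasDerivAt (fun θ => cos θ / √(a ^ 2 * sin θ ^ 2 + cos θ ^ 2))
      (-(a ^ 2 * sin θ) / √(a ^ 2 * sin θ ^ 2 + cos θ ^ 2) ^ 3) θ := by
  have h1 : HasDerivAt (fun θ => a ^ 2 * sin θ ^ 2 + cos θ ^ 2)
      (a ^ 2 * ((2 : ℕ) * sin θ ^ (2 - 1) * cos θ) + (2 : ℕ) * cos θ ^ (2 - 1) * -sin θ) θ :=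
    (((hasDerivAt_sin θ).pow 2).const_mul _).add ((hasDerivAt_cos θ).pow 2)
  have h2 := (hasDerivAt_cos θ).div (h1.sqrt hA.ne') (Real.sqrt_ne_zero'.2 hA)
  refine h2.congr_deriv ?_
  have hr := Real.sq_sqrt hA.le
  have hr0 := Real.sqrt_pos.2 hA
  generalize √(a ^ 2 * sin θ ^ 2 + cos θ ^ 2) = r at *
  have hs := sin_sq_add_cos_sq θ
  field_simp
  push_cast
  simp only [pow_one]
  rw [hr]
  linear_combination (-2 * a ^ 2 * sin θ) * hs

theorem alg_key (a b r s c v : ℝ) (ha : a ≠ 0) (hb : b ≠ 0) (hr : 0 < r) (hv : v = c / r)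
    (hab : b = a ^ 2 - 1) (hsc : s ^ 2 + c ^ 2 = 1) (hr2 : r ^ 2 = a ^ 2 * s ^ 2 + c ^ 2)
    (m C4 C2 C0 : ℝ) :
    3 * b ^ 2 / a ^ 2 * (1 - v ^ 2) ^ 2 * (b ^ 2 * m * v ^ 6 / (1 + b * v ^ 2) + C4 * v ^ 4 / a ^ 2
      + C2 * v ^ 2 * (1 + b * v ^ 2) / a ^ 4 + C0 * (1 + b * v ^ 2) ^ 2 / a ^ 6) *
      (-(a ^ 2 * s) / r ^ 3)
    = - (3 * a ^ 2 * b ^ 2 * s ^ 2 / (r ^ 2) ^ 6 *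
      (b ^ 2 * m * c ^ 6 + C4 * c ^ 4 + C2 * c ^ 2 + C0) * r * s ^ 3) := by
  have e1 : 1 + b * v ^ 2 = a ^ 2 / r ^ 2 := by
    rw [hv]; field_simp; rw [hr2, hab]; linear_combination a ^ 2 * hsc
  have e2 : 1 - v ^ 2 = a ^ 2 * s ^ 2 / r ^ 2 := by
    rw [hv]; field_simp; rw [hr2]; ring
  rw [e1, e2, hv]
  field_simp

theorem stmt16 (a : ℝ) (ha : 1 < a) (A : ℝ → ℝ)
    (hA : ∀ θ, A θ = a ^ 2 * sin θ ^ 2 + cos θ ^ 2) :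
    (π ^ 4 / 768) *
        ∫ θ in (0:ℝ)..π,
          3 * a ^ 2 * (a ^ 2 - 1) ^ 2 * sin θ ^ 2 / A θ ^ 6 *
              ((a ^ 2 - 1) ^ 2 * (5 * a ^ 2 - 8) * cos θ ^ 6
                + (-15 * a ^ 6 + 22 * a ^ 4 - 55 * a ^ 2 + 48) * cos θ ^ 4
                + (15 * a ^ 6 + 10 * a ^ 4 + 31 * a ^ 2 - 8) * cos θ ^ 2
                - 5 * a ^ 6 - 14 * a ^ 4 + 3 * a ^ 2) *
            Real.sqrt (A θ) * sin θ ^ 3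
      = π ^ 4 / (40320 * a ^ 6 * (a ^ 2 - 1)) *
          (1241 * a ^ 8 - 1346 * a ^ 6 - 2232 * a ^ 4 + 1648 * a ^ 2 - 256
            - 1575 * a ^ 8 * (a ^ 2 - 8 / 5) *
                (arctan (Real.sqrt (a ^ 2 - 1)) / Real.sqrt (a ^ 2 - 1))) := by
  obtain rfl : A = fun θ => a ^ 2 * sin θ ^ 2 + cos θ ^ 2 := funext hA
  clear hA
  have ha0 : a ≠ 0 := by positivity
  have hbp : 0 < a ^ 2 - 1 := by nlinarith
  have hpos : ∀ θ, 0 < a ^ 2 * sin θ ^ 2 + cos θ ^ 2 := fun θ => by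
    nlinarith [sin_sq_add_cos_sq θ, mul_nonneg hbp.le (sq_nonneg (sin θ))]
  obtain ⟨b, hb⟩ : ∃ b, b = a ^ 2 - 1 := ⟨_, rfl⟩
  obtain ⟨w, hw⟩ : ∃ w, w = √(a ^ 2 - 1) := ⟨_, rfl⟩
  have hw0 : 0 < w := hw ▸ Real.sqrt_pos.2 hbp
  have hw2 : w ^ 2 = b := by rw [hw, hb, Real.sq_sqrt hbp.le]
  have hb0 : 0 < b := hb ▸ hbp
  obtain ⟨m, hm⟩ : ∃ m, m = 5 * a ^ 2 - 8 := ⟨_, rfl⟩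
  obtain ⟨C4, hC4⟩ : ∃ m, m = -15 * a ^ 6 + 22 * a ^ 4 - 55 * a ^ 2 + 48 := ⟨_, rfl⟩
  obtain ⟨C2, hC2⟩ : ∃ m, m = 15 * a ^ 6 + 10 * a ^ 4 + 31 * a ^ 2 - 8 := ⟨_, rfl⟩
  obtain ⟨C0, hC0⟩ : ∃ m, m = - 5 * a ^ 6 - 14 * a ^ 4 + 3 * a ^ 2 := ⟨_, rfl⟩
  obtain ⟨e0, he0⟩ : ∃ m, m = C0 / a ^ 6 := ⟨_, rfl⟩
  obtain ⟨e1, he1⟩ : ∃ m, m = C2 / a ^ 4 + 2 * b * C0 / a ^ 6 := ⟨_, rfl⟩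
  obtain ⟨e2, he2⟩ : ∃ m, m = C4 / a ^ 2 + b * C2 / a ^ 4 + b ^ 2 * C0 / a ^ 6 := ⟨_, rfl⟩
  obtain ⟨k, hk⟩ : ∃ m, m = 3 * b ^ 2 / a ^ 2 := ⟨_, rfl⟩
  obtain ⟨p0, hp0⟩ : ∃ p, p = k * (e0 + m * (b + 1) ^ 2 / b ^ 3) := ⟨_, rfl⟩
  obtain ⟨p1, hp1⟩ : ∃ p, p = k * (e1 - 2 * e0 - m * (b + 1) ^ 2 / b ^ 2) := ⟨_, rfl⟩
  obtain ⟨p2, hp2⟩ : ∃ p, p = k * (e2 - 2 * e1 + e0 + m * (b + 1) ^ 2 / b) := ⟨_, rfl⟩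
  obtain ⟨p3, hp3⟩ : ∃ p, p = k * (e1 - 2 * e2 - m * (2 * b + 1)) := ⟨_, rfl⟩
  obtain ⟨p4, hp4⟩ : ∃ p, p = k * (e2 + m * b) := ⟨_, rfl⟩
  obtain ⟨K, hK⟩ : ∃ p, p = - k * m * (b + 1) ^ 2 / b ^ 3 := ⟨_, rfl⟩
  have hpoly : ∀ v : ℝ, p0 + p1 * v ^ 2 + p2 * v ^ 4 + p3 * v ^ 6 + p4 * v ^ 8
      + K / (1 + w ^ 2 * v ^ 2) =
      3 * b ^ 2 / a ^ 2 * (1 - v ^ 2) ^ 2 * (b ^ 2 * m * v ^ 6 / (1 + b * v ^ 2)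
      + C4 * v ^ 4 / a ^ 2
      + C2 * v ^ 2 * (1 + b * v ^ 2) / a ^ 4 + C0 * (1 + b * v ^ 2) ^ 2 / a ^ 6) := by
    intro v
    have h1 : 1 + b * v ^ 2 ≠ 0 := by positivity
    have hE : C4 * v ^ 4 / a ^ 2
      + C2 * v ^ 2 * (1 + b * v ^ 2) / a ^ 4 + C0 * (1 + b * v ^ 2) ^ 2 / a ^ 6
      = e0 + e1 * v ^ 2 + e2 * v ^ 4 := by
      rw [he0, he1, he2]; ring
    have hE2 : ∀ x : ℝ, x + C4 * v ^ 4 / a ^ 2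
      + C2 * v ^ 2 * (1 + b * v ^ 2) / a ^ 4 + C0 * (1 + b * v ^ 2) ^ 2 / a ^ 6
      = x + (e0 + e1 * v ^ 2 + e2 * v ^ 4) := fun x => by rw [← hE]; ring
    rw [← hk, hw2, hE2,
      hp0, hp1, hp2, hp3, hp4, hK]
    clear hE hE2
    clear hp0 hp1 hp2 hp3 hp4 hK he0 he1 he2 hk hm hC0 hC2 hC4
    field_simp
    ring
  have hint : ∫ θ in (0:ℝ)..π,
          3 * a ^ 2 * b ^ 2 * sin θ ^ 2 / (a ^ 2 * sin θ ^ 2 + cos θ ^ 2) ^ 6 *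
              (b ^ 2 * m * cos θ ^ 6 + C4 * cos θ ^ 4 + C2 * cos θ ^ 2 + C0) *
            √(a ^ 2 * sin θ ^ 2 + cos θ ^ 2) * sin θ ^ 3
      = 2 * (p0 + p1 / 3 + p2 / 5 + p3 / 7 + p4 / 9 + K * (arctan w / w)) := by
    rw [intervalIntegral.integral_eq_sub_of_hasDerivAt
      (f := fun θ => -((fun v : ℝ => p0 * v + p1 * v ^ 3 / 3 + p2 * v ^ 5 / 5 + p3 * v ^ 7 / 7
      + p4 * v ^ 9 / 9 + K * (arctan (w * v) / w))
        (cos θ / √(a ^ 2 * sin θ ^ 2 + cos θ ^ 2))))]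
    · simp
      ring
    · intro θ _
      have h := ((hasDeriv_G w p0 p1 p2 p3 p4 K
        (cos θ / √(a ^ 2 * sin θ ^ 2 + cos θ ^ 2)) hw0.ne').comp θ
          (hasDeriv_v a θ (hpos θ))).neg
      refine h.congr_deriv ?_
      rw [hpoly, alg_key a b _ (sin θ) (cos θ) _ ha0 hb0.ne' (Real.sqrt_pos.2 (hpos θ)) rfl hb
        (sin_sq_add_cos_sq θ) (Real.sq_sqrt (hpos θ).le), Real.sq_sqrt (hpos θ).le, neg_neg]
    · apply Continuous.intervalIntegrable
      have : ∀ θ, (a ^ 2 * sin θ ^ 2 + cos θ ^ 2) ^ 6 ≠ 0 := fun θ => (pow_pos (hpos θ) 6).ne'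
      fun_prop (disch := assumption)
  have hcongr : ∀ θ : ℝ, b ^ 2 * m * cos θ ^ 6 + C4 * cos θ ^ 4 + C2 * cos θ ^ 2
      - 5 * a ^ 6 - 14 * a ^ 4 + 3 * a ^ 2
      = b ^ 2 * m * cos θ ^ 6 + C4 * cos θ ^ 4 + C2 * cos θ ^ 2 + C0 := by
    intro θ; rw [hC0]; ring
  rw [← hw]
  simp only [← hb, ← hm, ← hC4, ← hC2, hcongr]
  rw [hint, hp0, hp1, hp2, hp3, hp4, hK, hk, he0, he1, he2, hm, hC0, hC2, hC4]
  generalize arctan w / w = T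
  have hab : a ^ 2 = b + 1 := by rw [hb]; ring
  have h4 : a ^ 4 = (b + 1) ^ 2 := by rw [← hab]; ring
  have h6 : a ^ 6 = (b + 1) ^ 3 := by rw [← hab]; ring
  have h8 : a ^ 8 = (b + 1) ^ 4 := by rw [← hab]; ring
  rw [h4, h6, h8, hab]
  have : b + 1 ≠ 0 := by positivity
  clear hint hpoly hcongr hp0 hp1 hp2 hp3 hp4 hK he0 he1 he2 hk hm hC0 hC2 hC4
  field_simp
  ring
end
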